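/- Let F be an anisotropic area integrand on ℝ^(n+1). Then for every nonzero p in the span of {φ¹,…,φⁿ}: lim_{s→∞} F(sp − φ⁰)·D²F|_{sp−φ⁰}(sp,sp) = F(p)·D²F|_p(φ⁰,φ⁰), and this limit is strictly positive. -/

import Mathlib

open Real Filter Set

/-- First derivative of `F` at `ν` applied to `v`. -/
noncomputable def D1 {E : Type*} [NormedAddCommGroup E] [NormedSpace ℝ E]
    (F : E → ℝ) (ν v : E) : ℝ :=
  fderiv ℝ F ν v

/-- Second derivative of `F` at `ν` as a bilinear form. -/
noncomputable def D2 {E : Type*} [NormedAddCommGroup E] [NormedSpace ℝ E]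
    (F : E → ℝ) (ν v w : E) : ℝ :=
  iteratedFDeriv ℝ 2 F ν ![v, w]

/-- Third derivative of `F` at `ν` as a trilinear form. -/
noncomputable def D3 {E : Type*} [NormedAddCommGroup E] [NormedSpace ℝ E]
    (F : E → ℝ) (ν v w z : E) : ℝ :=
  iteratedFDeriv ℝ 3 F ν ![v, w, z]

/-- `F : ℝ^(n+1) → ℝ` is an anisotropic area integrand: positive away from `0`,
convex, `C³` away from `0`, positively homogeneous of degree one, and with
uniformly convex sublevel sets (encoded via positivity of the second derivative
in non-radial directions). -/
def IsAreaIntegrand {n : ℕ} (F : (Fin (n + 1) → ℝ) → ℝ) : Prop :=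
  (∀ v : Fin (n + 1) → ℝ, v ≠ 0 → 0 < F v) ∧
  ConvexOn ℝ Set.univ F ∧
  ContDiffOn ℝ 3 F {(0 : Fin (n + 1) → ℝ)}ᶜ ∧
  (∀ (c : ℝ) (v : Fin (n + 1) → ℝ), 0 < c → F (c • v) = c * F v) ∧
  (∀ ν w : Fin (n + 1) → ℝ, ν ≠ 0 → (∀ c : ℝ, w ≠ c • ν) → 0 < D2 F ν w w)

/-- The symmetry condition: `F(p + φ⁰) = F(p − φ⁰)` for `p` in the span of
`φ¹, …, φⁿ` (i.e. with vanishing `0`-th coordinate). -/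
def SymmCond {n : ℕ} (F : (Fin (n + 1) → ℝ) → ℝ) : Prop :=
  ∀ p : Fin (n + 1) → ℝ, p 0 = 0 →
    F (p + Pi.single 0 1) = F (p - Pi.single 0 1)

/-- Smallness-of-third-derivatives condition with constant `C₁`, for directions
tangent to the level set of `F` at `ν`. -/
def SmallThird {n : ℕ} (F : (Fin (n + 1) → ℝ) → ℝ) (C₁ : ℝ) : Prop :=
  ∀ ν p q r : Fin (n + 1) → ℝ, ν ≠ 0 →
    D1 F ν p = 0 → D1 F ν q = 0 → D1 F ν r = 0 →
    F ν ^ 2 * D3 F ν p q r ≤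
      C₁ * Real.sqrt (F ν ^ 3 * D2 F ν p p * D2 F ν q q * D2 F ν r r)

section Homogeneous

variable {E : Type*} [NormedAddCommGroup E] [NormedSpace ℝ E] {F : E → ℝ}

theorem D2_eq_fderiv_fderiv (F : E → ℝ) (ν v w : E) :
    D2 F ν v w = fderiv ℝ (fderiv ℝ F) ν v w := by
  simp [D2, iteratedFDeriv_two_apply]

/-- The derivative of a function homogeneous of degree one is homogeneous of degree zero. -/
theorem fderiv_smul_of_homogeneous (h : ∀ (c : ℝ) (v : E), 0 < c → F (c • v) = c * F v)
    {c : ℝ} (hc : 0 < c) (ν : E) : fderiv ℝ F (c • ν) = fderiv ℝ F ν := by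
  have hcomp : fderiv ℝ (fun x => F (c • x)) ν = c • fderiv ℝ F (c • ν) := fderiv_comp_smul c
  have hmul : (fun x => F (c • x)) = c • F := funext fun x => h c x hc
  have : Invertible c := invertibleOfNonzero hc.ne'
  rw [hmul, fderiv_const_smul_of_invertible] at hcomp
  exact (smul_right_injective _ hc.ne' hcomp).symm

/-- The second derivative of a function homogeneous of degree one is homogeneous of
degree `-1`. -/
theorem mul_D2_smul_of_homogeneous (h : ∀ (c : ℝ) (v : E), 0 < c → F (c • v) = c * F v)
    {c : ℝ} (hc : 0 < c) (ν v w : E) : c * D2 F (c • ν) v w = D2 F ν v w := by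
  have hcomp : fderiv ℝ (fun x => fderiv ℝ F (c • x)) ν = c • fderiv ℝ (fderiv ℝ F) (c • ν) :=
    fderiv_comp_smul c
  have hconst : (fun x => fderiv ℝ F (c • x)) = fderiv ℝ F :=
    funext fun x => fderiv_smul_of_homogeneous h hc x
  rw [hconst] at hcomp
  simp [D2_eq_fderiv_fderiv, hcomp]

/-- `ν ↦ F ν * D2 F ν v w` is homogeneous of degree zero when `F` is homogeneous of degree
one. -/
theorem mul_D2_homogeneous (h : ∀ (c : ℝ) (v : E), 0 < c → F (c • v) = c * F v)
    {c : ℝ} (hc : 0 < c) (ν v w : E) :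
    F (c • ν) * D2 F (c • ν) v w = F ν * D2 F ν v w := by
  rw [h c ν hc, ← mul_D2_smul_of_homogeneous h hc ν v w]
  ring

/-- The second derivative of a function homogeneous of degree one vanishes in the radial
direction. -/
theorem fderiv_fderiv_self_of_homogeneous
    (h : ∀ (c : ℝ) (v : E), 0 < c → F (c • v) = c * F v) {ν : E}
    (hd : DifferentiableAt ℝ (fderiv ℝ F) ν) : fderiv ℝ (fderiv ℝ F) ν ν = 0 := by
  have hray : HasDerivAt (fun c : ℝ => c • ν) ν 1 := by
    simpa using (hasDerivAt_id (1 : ℝ)).smul_const ν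
  have hcomp : HasDerivAt (fun c : ℝ => fderiv ℝ F (c • ν)) (fderiv ℝ (fderiv ℝ F) ν ν) 1 :=
    HasFDerivAt.comp_hasDerivAt (1 : ℝ) (by simpa using hd.hasFDerivAt) hray
  have hconst : (fun c : ℝ => fderiv ℝ F (c • ν)) =ᶠ[nhds 1] fun _ => fderiv ℝ F ν := by
    filter_upwards [lt_mem_nhds (zero_lt_one' ℝ)] with c hc
    exact fderiv_smul_of_homogeneous h hc ν
  exact hcomp.unique ((hasDerivAt_const (1 : ℝ) (fderiv ℝ F ν)).congr_of_eventuallyEq hconst)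

/-- Only the part of the directions transverse to the base point contributes to the second
derivative. -/
theorem D2_add_self_of_homogeneous (h : ∀ (c : ℝ) (v : E), 0 < c → F (c • v) = c * F v)
    {ν : E} (hF : ContDiffAt ℝ 2 F ν) (v : E) : D2 F ν (ν + v) (ν + v) = D2 F ν v v := by
  have hd : DifferentiableAt ℝ (fderiv ℝ F) ν :=
    (hF.fderiv_right (m := 1) (by norm_num)).differentiableAt one_ne_zero
  have hrad := fderiv_fderiv_self_of_homogeneous h hd
  have hsymm : fderiv ℝ (fderiv ℝ F) ν v ν = fderiv ℝ (fderiv ℝ F) ν ν v :=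
    hF.isSymmSndFDerivAt (by simp) v ν
  simp [D2_eq_fderiv_fderiv, hrad, hsymm]

theorem continuousAt_D2 {ν : E} (hF : ContDiffAt ℝ 2 F ν) (v w : E) :
    ContinuousAt (fun x => D2 F x v w) ν := by
  have hc : ContinuousAt (fderiv ℝ (fderiv ℝ F)) ν :=
    ((hF.fderiv_right (m := 1) (by norm_num)).fderiv_right (m := 0) (by norm_num)).continuousAt
  simp only [D2_eq_fderiv_fderiv]
  exact (hc.clm_apply continuousAt_const).clm_apply continuousAt_const

end Homogeneous

/-- For nonzero `p ∈ span{φ¹,…,φⁿ}`,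
`F(sp−φ⁰)·D²F|_{sp−φ⁰}(sp,sp) → F(p)·D²F|_p(φ⁰,φ⁰) > 0` as `s → ∞`. -/
theorem limit_G_pp_at_infinity
    {n : ℕ} (F : (Fin (n + 1) → ℝ) → ℝ) (hF : IsAreaIntegrand F) :
    ∀ p : Fin (n + 1) → ℝ, p ≠ 0 → p 0 = 0 →
      Filter.Tendsto
        (fun s : ℝ =>
          F (s • p - Pi.single 0 1) *
            D2 F (s • p - Pi.single 0 1) (s • p) (s • p))
        Filter.atTop
        (nhds (F p * D2 F p (Pi.single 0 1) (Pi.single 0 1))) ∧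
      0 < F p * D2 F p (Pi.single 0 1) (Pi.single 0 1) := by
  obtain ⟨hpos, -, hC, hhom, hconv⟩ := hF
  intro p hp hp0
  set e : Fin (n + 1) → ℝ := Pi.single 0 1 with he
  have hsmooth : ∀ ν : Fin (n + 1) → ℝ, ν ≠ 0 → ContDiffAt ℝ 2 F ν := fun ν hν =>
    (hC.contDiffAt (isOpen_compl_singleton.mem_nhds hν)).of_le (by norm_num)
  refine ⟨?_, mul_pos (hpos p hp) (hconv p e hp fun c hc => ?_)⟩
  · have hlim : Tendsto (fun s : ℝ => p - s⁻¹ • e) atTop (nhds p) := by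
      simpa using (tendsto_const_nhds (x := p)).sub
        ((tendsto_inv_atTop_zero (𝕜 := ℝ)).smul_const e)
    have hcont : ContinuousAt (fun ν => F ν * D2 F ν e e) p :=
      (hsmooth p hp).continuousAt.mul (continuousAt_D2 (hsmooth p hp) e e)
    refine (hcont.tendsto.comp hlim).congr' ?_
    filter_upwards [eventually_gt_atTop 0] with s hs
    have hν : s • p - e ≠ 0 := fun h0 => by
      have := congrFun h0 0
      simp [he, hp0] at this
    have hscale : s • p - e = s • (p - s⁻¹ • e) := by
      rw [smul_sub, smul_inv_smul₀ hs.ne']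
    have hrad := D2_add_self_of_homogeneous hhom (hsmooth _ hν) e
    rw [sub_add_cancel] at hrad
    rw [hrad, hscale, mul_D2_homogeneous hhom hs]
    rfl
  · have := congrFun hc 0
    simp [he, hp0] at this
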